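/- Let C be any real 2×n matrix and R a real symmetric positive definite 2×2 matrix. If f is a strictly decreasing and m-positive function on real symmetric n×n matrices, then the function Σ ↦ f(S(Σ)) is strictly decreasing and m-positive; that is, f(S(Σ + Δ)) < f(S(Σ)) and f(S(Σ)) > 0 for all symmetric positive definite n×n matrices Σ and Δ. -/

import Mathlib

open Matrix

/-- The map `S(Σ) = Σ - Σ Cᵀ (C Σ Cᵀ + R)⁻¹ C Σ` of the paper. -/
noncomputable def Sfun {n : ℕ} (C : Matrix (Fin 2) (Fin n) ℝ)
    (R : Matrix (Fin 2) (Fin 2) ℝ) (S : Matrix (Fin n) (Fin n) ℝ) :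
    Matrix (Fin n) (Fin n) ℝ :=
  S - S * Cᵀ * (C * S * Cᵀ + R)⁻¹ * (C * S)

theorem inv_sub_inv_posDef {n : ℕ} {A D : Matrix (Fin n) (Fin n) ℝ} (hA : A.PosDef)
    (hD : D.PosDef) : (A⁻¹ - (A + D)⁻¹).PosDef := by
  have h1 : (D⁻¹ + A⁻¹).PosDef := hD.inv.add hA.inv
  have h := add_mul_mul_inv_eq_sub (A := A) (U := (1 : Matrix (Fin n) (Fin n) ℝ)) (C := D)
    (V := (1 : Matrix (Fin n) (Fin n) ℝ)) hA.isUnit hD.isUnit (by simpa using h1.isUnit)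
  simp only [Matrix.one_mul, Matrix.mul_one] at h
  rw [h, sub_sub_cancel]
  have h2 := (Matrix.IsUnit.posDef_star_left_conjugate_iff hA.inv.isUnit).2 h1.inv
  have h3 : star A⁻¹ = A⁻¹ := hA.inv.isHermitian
  rwa [h3] at h2

theorem gram_posSemidef {n : ℕ} (C : Matrix (Fin 2) (Fin n) ℝ)
    (R : Matrix (Fin 2) (Fin 2) ℝ) (hR : R.PosDef) : (Cᵀ * R⁻¹ * C).PosSemidef := by
  simpa using hR.inv.posSemidef.conjTranspose_mul_mul_same C

theorem Sfun_eq {n : ℕ} (C : Matrix (Fin 2) (Fin n) ℝ)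
    (R : Matrix (Fin 2) (Fin 2) ℝ) (hR : R.PosDef) (S : Matrix (Fin n) (Fin n) ℝ)
    (hS : S.PosDef) : Sfun C R S = (S⁻¹ + Cᵀ * R⁻¹ * C)⁻¹ := by
  have e1 : S⁻¹⁻¹ = S := nonsing_inv_nonsing_inv _ ((isUnit_iff_isUnit_det _).1 hS.isUnit)
  have e2 : R⁻¹⁻¹ = R := nonsing_inv_nonsing_inv _ ((isUnit_iff_isUnit_det _).1 hR.isUnit)
  have h1 : (R + C * S * Cᵀ).PosDef :=
    hR.add_posSemidef (by simpa using hS.posSemidef.mul_mul_conjTranspose_same C)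
  rw [add_mul_mul_inv_eq_sub (A := S⁻¹) (U := Cᵀ) (C := R⁻¹) (V := C) hS.inv.isUnit hR.inv.isUnit (by rw [e1, e2]; exact h1.isUnit),
    e1, e2, Sfun, add_comm R]
  simp only [Matrix.mul_assoc]

/-- Let `C` be any real `2 × n` matrix and `R` a real symmetric positive
definite `2 × 2` matrix.  If `f` is strictly decreasing and m-positive on real symmetric
`n × n` matrices, then `Σ ↦ f (S(Σ))` is strictly decreasing and m-positive: for all
symmetric positive definite `Σ` and `Δ`, `f (S(Σ + Δ)) < f (S(Σ))` and `f (S(Σ)) > 0`. -/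
theorem stmt_6 {n : ℕ} (C : Matrix (Fin 2) (Fin n) ℝ)
    (R : Matrix (Fin 2) (Fin 2) ℝ) (hR : R.PosDef)
    (f : Matrix (Fin n) (Fin n) ℝ → ℝ)
    (hf_dec : ∀ S Δ : Matrix (Fin n) (Fin n) ℝ, S.PosDef → Δ.PosDef → f (S + Δ) < f S)
    (hf_pos : ∀ S : Matrix (Fin n) (Fin n) ℝ, S.PosDef → 0 < f S) :
    ∀ S Δ : Matrix (Fin n) (Fin n) ℝ, S.PosDef → Δ.PosDef →
      f (Sfun C R (S + Δ)) < f (Sfun C R S) ∧ 0 < f (Sfun C R S) := by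
  intro S Δ hS hΔ
  have hK := gram_posSemidef C R hR
  have hSΔ := hS.add hΔ
  have hP := hS.inv.add_posSemidef hK
  have hQ := hSΔ.inv.add_posSemidef hK
  have hD := inv_sub_inv_posDef hQ (inv_sub_inv_posDef hS hΔ)
  have e : (S + Δ)⁻¹ + Cᵀ * R⁻¹ * C + (S⁻¹ - (S + Δ)⁻¹) = S⁻¹ + Cᵀ * R⁻¹ * C := by abel
  rw [e] at hD
  rw [Sfun_eq C R hR S hS, Sfun_eq C R hR _ hSΔ]
  refine ⟨?_, hf_pos _ hP.inv⟩
  have := hf_dec _ _ hP.inv hD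
  rwa [add_sub_cancel] at this
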